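/- (Theorem 2) Let p_1 < p_2 be distinct primes, q = p_1·p_2, m_1, m_2 ≥ 2, m = m_1 + m_2, L = p_1^{m_1}·p_2^{m_2}. Fix functions f_1, …, f_{m_1−1}, f'_1, …, f'_{m_1−1}, h_1, …, h_{m_2−1}, h'_1, …, h'_{m_2−1} : ℤ_q → ℤ_q. For functions f_0, h_0, g_1, …, g_{m_1}, g'_1, …, g'_{m_2} : ℤ_q → ℤ_q, a constant γ ∈ ℤ_q, a permutation π of {1, …, m_1} and a permutation π' of {m_1+1, …, m}, define f on the domain of mixed-radix digit vectors by f(x_1,…,x_m) = (q/p_1)·∑_{i=1}^{m_1−1} f_i(x_{π(i)}) f'_i(x_{π(i+1)}) + ∑_{α=1}^{m_1} g_α(x_α) + (q/p_2)·∑_{j=1}^{m_2−1} h_j(x_{π'(m_1+j)}) h'_j(x_{π'(m_1+j+1)}) + ∑_{β=1}^{m_2} g'_β(x_{β+m_1}) + γ·f_0(x_{π(m_1)})·h_0(x_{π'(m_1+1)}). For t = p_1·t_2 + t_1 with t_1 ∈ {0,…,p_1−1}, t_2 ∈ {0,…,p_2−1}, let ψ(C_t) be the code whose sequences, indexed by (d_1,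 d_2) ∈ {0,…,p_1−1}×{0,…,p_2−1}, have x-th entry ξ_q^{f(x_1,…,x_m) + (q/p_1)(d_1·x_{π(1)} + t_1·x_{π(m_1)}) + (q/p_2)(d_2·x_{π'(m_1+1)} + t_2·x_{π'(m)})} for x ∈ {0,…,L−1} with mixed-radix digits (x_1,…,x_m). Then the following are equivalent: (a) for every choice of f_0, h_0, the g_α, the g'_β, γ, π, π', the family {ψ(C_t) : 0 ≤ t < p_1 p_2} is a (p_1 p_2, L)-CCC; (b) every f_i and f'_i (1 ≤ i ≤ m_1−1) permutes {0,…,p_1−1} under reduction modulo p_1 and every h_j and h'_j (1 ≤ j ≤ m_2−1) permutes {0,…,p_2−1} under reduction modulo p_2. -/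

import Mathlib

open scoped Classical

/-- Aperiodic cross-correlation function (ACCF) of two length-`L` complex sequences
at integer shift `τ`:
`Θ(a,b)(τ) = ∑_{t=0}^{L−τ−1} a_t · conj(b_{t+τ})` for `0 ≤ τ`, and
`Θ(a,b)(τ) = ∑_{t=0}^{L+τ−1} a_{t−τ} · conj(b_t)` for `τ < 0`. -/
noncomputable def accf (L : ℕ) (a b : ℕ → ℂ) (τ : ℤ) : ℂ :=
  if 0 ≤ τ then
    ∑ t ∈ Finset.range (L - τ.toNat), a t * (starRingEnd ℂ) (b (t + τ.toNat))
  else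
    ∑ t ∈ Finset.range (L - (-τ).toNat), a (t + (-τ).toNat) * (starRingEnd ℂ) (b t)

/-- ACCF (sum) of two codes, i.e. tuples of length-`L` sequences indexed by `κ`:
`Θ(C, C')(τ) = ∑_m Θ(c^m, c'^m)(τ)`. -/
noncomputable def codeACCF {κ : Type*} [Fintype κ] (L : ℕ) (C C' : κ → ℕ → ℂ)
    (τ : ℤ) : ℂ :=
  ∑ m : κ, accf L (C m) (C' m) τ

/-- A family of codes `C_k` (`k : ι`), each a (`card κ`)-tuple of length-`L` sequences,
is a set of complete complementary codes (CCC) if the number of sequences per code equals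
the number `K` of codes, `Θ(C_{k₁}, C_{k₂})(0) = K·L`, and all other aperiodic
auto/cross-correlation sums with `|τ| < L` vanish. -/
noncomputable def IsCCC {ι κ : Type*} [Fintype ι] [Fintype κ] (L : ℕ)
    (C : ι → κ → ℕ → ℂ) : Prop :=
  Fintype.card κ = Fintype.card ι ∧
  ∀ k₁ k₂ : ι, ∀ τ : ℤ, |τ| < (L : ℤ) →
    codeACCF L (C k₁) (C k₂) τ =
      if τ = 0 ∧ k₁ = k₂ then ((Fintype.card ι : ℂ) * (L : ℂ)) else 0

/-- `ξ_q = exp(2πi/q)`, a primitive `q`-th root of unity. -/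
noncomputable def xi (q : ℕ) : ℂ := Complex.exp (2 * Real.pi * Complex.I / q)

/-- Mixed-radix digits of `x ∈ {0,…,p₁^{m₁}p₂^{m₂}−1}` (with `x = σ₁ + σ₂·p₁^{m₁}`):
for a 0-based position `j`, the digit is the `(j+1)`-st base-`p₁` digit of `σ₁` if
`j < m₁`, and the `(j−m₁+1)`-st base-`p₂` digit of `σ₂` otherwise. -/
def mdig (p₁ p₂ m₁ x j : ℕ) : ℕ :=
  if j < m₁ then x % p₁ ^ m₁ / p₁ ^ j % p₁
  else x / p₁ ^ m₁ / p₂ ^ (j - m₁) % p₂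

/-- Mixed-radix digit regarded as an element of `ℤ_q`. -/
def mdigZ (q p₁ p₂ m₁ x j : ℕ) : ZMod q := ((mdig p₁ p₂ m₁ x j : ℕ) : ZMod q)

/-- `φ : ℤ_q → ℤ_q` permutes `{0,…,p−1}` under reduction modulo `p`: the map sending
`u ∈ {0,…,p−1}` to `φ(u) mod p` is a bijection onto `ℤ_p`. -/
def PermutesMod (q p : ℕ) (φ : ZMod q → ZMod q) : Prop :=
  Function.Bijective (fun u : Fin p => (((φ ((u : ℕ) : ZMod q)).val : ℕ) : ZMod p))

/-- The function `f(x_1,…,x_m)` of Theorem 2 (two primes, `q = p₁p₂`, `m = m₁ + m₂`),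
evaluated on the mixed-radix digit vector of `x`:
`f = (q/p₁)∑ f_i(x_{π(i)})f'_i(x_{π(i+1)}) + ∑ g_α(x_α)
   + (q/p₂)∑ h_j(x_{π'(m₁+j)})h'_j(x_{π'(m₁+j+1)}) + ∑ g'_β(x_{β+m₁})
   + γ·f₀(x_{π(m₁)})·h₀(x_{π'(m₁+1)})`,
where `π` permutes the first block of `m₁` positions and `π'` the second block of
`m₂` positions (encoded as a permutation of the offsets within the block). -/
def f2 (p₁ p₂ m₁ m₂ : ℕ) (hm₁ : 2 ≤ m₁) (hm₂ : 2 ≤ m₂)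
    (fi f'i : Fin (m₁ - 1) → ZMod (p₁ * p₂) → ZMod (p₁ * p₂))
    (hj h'j : Fin (m₂ - 1) → ZMod (p₁ * p₂) → ZMod (p₁ * p₂))
    (f₀ h₀ : ZMod (p₁ * p₂) → ZMod (p₁ * p₂))
    (g : Fin m₁ → ZMod (p₁ * p₂) → ZMod (p₁ * p₂))
    (g' : Fin m₂ → ZMod (p₁ * p₂) → ZMod (p₁ * p₂))
    (γ : ZMod (p₁ * p₂)) (π : Equiv.Perm (Fin m₁)) (π' : Equiv.Perm (Fin m₂))
    (x : ℕ) : ZMod (p₁ * p₂) :=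
  let D : ℕ → ZMod (p₁ * p₂) := fun j => mdigZ (p₁ * p₂) p₁ p₂ m₁ x j
  ((p₁ * p₂ / p₁ : ℕ) : ZMod (p₁ * p₂)) *
      (∑ i : Fin (m₁ - 1),
        fi i (D (π (Fin.castLE (by omega) i))) *
          f'i i (D (π (Fin.cast (by omega) i.succ)))) +
    (∑ α : Fin m₁, g α (D α)) +
    ((p₁ * p₂ / p₂ : ℕ) : ZMod (p₁ * p₂)) *
      (∑ j : Fin (m₂ - 1),
        hj j (D (m₁ + π' (Fin.castLE (by omega) j))) *
          h'j j (D (m₁ + π' (Fin.cast (by omega) j.succ)))) +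
    (∑ β : Fin m₂, g' β (D (m₁ + β))) +
    γ * f₀ (D (π ⟨m₁ - 1, by omega⟩)) * h₀ (D (m₁ + π' ⟨0, by omega⟩))

/-- The code `ψ(C_t)` of Theorem 2, for `t = p₁·t₂ + t₁` (`t₁ = t % p₁`,
`t₂ = t / p₁`): its sequences are indexed by `(d₁, d₂) ∈ {0,…,p₁−1}×{0,…,p₂−1}` and
have `x`-th entry
`ξ_q^{f(x) + (q/p₁)(d₁x_{π(1)} + t₁x_{π(m₁)}) + (q/p₂)(d₂x_{π'(m₁+1)} + t₂x_{π'(m)})}`. -/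
noncomputable def psi2 (p₁ p₂ m₁ m₂ : ℕ) (hm₁ : 2 ≤ m₁) (hm₂ : 2 ≤ m₂)
    (fi f'i : Fin (m₁ - 1) → ZMod (p₁ * p₂) → ZMod (p₁ * p₂))
    (hj h'j : Fin (m₂ - 1) → ZMod (p₁ * p₂) → ZMod (p₁ * p₂))
    (f₀ h₀ : ZMod (p₁ * p₂) → ZMod (p₁ * p₂))
    (g : Fin m₁ → ZMod (p₁ * p₂) → ZMod (p₁ * p₂))
    (g' : Fin m₂ → ZMod (p₁ * p₂) → ZMod (p₁ * p₂))
    (γ : ZMod (p₁ * p₂)) (π : Equiv.Perm (Fin m₁)) (π' : Equiv.Perm (Fin m₂))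
    (t : ℕ) : Fin p₁ × Fin p₂ → ℕ → ℂ :=
  fun d x =>
    let D : ℕ → ZMod (p₁ * p₂) := fun j => mdigZ (p₁ * p₂) p₁ p₂ m₁ x j
    xi (p₁ * p₂) ^
      (f2 p₁ p₂ m₁ m₂ hm₁ hm₂ fi f'i hj h'j f₀ h₀ g g' γ π π' x +
          ((p₁ * p₂ / p₁ : ℕ) : ZMod (p₁ * p₂)) *
            (((d.1 : ℕ) : ZMod (p₁ * p₂)) * D (π ⟨0, by omega⟩) +
              ((t % p₁ : ℕ) : ZMod (p₁ * p₂)) * D (π ⟨m₁ - 1, by omega⟩)) +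
          ((p₁ * p₂ / p₂ : ℕ) : ZMod (p₁ * p₂)) *
            (((d.2 : ℕ) : ZMod (p₁ * p₂)) * D (m₁ + π' ⟨0, by omega⟩) +
              ((t / p₁ : ℕ) : ZMod (p₁ * p₂)) * D (m₁ + π' ⟨m₂ - 1, by omega⟩))).val

theorem Fintype.sum_eq_zero_of_shift {A ι : Type*} [AddCommGroup A] [Fintype A] [Fintype ι]
    [Nonempty ι] (G : A → ℂ) (s : ι → A) (h : ∀ z, ∑ i, G (z + s i) = 0) : ∑ z, G z = 0 := by
  have key : (Fintype.card ι : ℂ) * ∑ z, G z = 0 := by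
    calc (Fintype.card ι : ℂ) * ∑ z, G z = ∑ i, ∑ z, G (z + s i) := by
          have (i : ι) : ∑ z, G (z + s i) = ∑ z, G z := Equiv.sum_comp (Equiv.addRight (s i)) G
          simp [this]
      _ = 0 := by rw [Finset.sum_comm]; simp [h]
  simpa using key

/-- The quadratic-type form `∑ i, F i (x i) * F' i (x (i + 1))` attached to a path. -/
def chain {r : ℕ} {D R : Type*} [CommRing R] (F F' : Fin r → D → R) (x : Fin (r + 1) → D) : R :=
  ∑ i, F i (x i.castSucc) * F' i (x i.succ)

theorem chain_sub_chain {r : ℕ} {D R : Type*} [CommRing R] (F F' : Fin r → D → R) (v : Fin r)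
    {x y : Fin (r + 1) → D} (h : ∀ k ≤ v.castSucc, x k = y k) :
    chain F F' x - chain F F' y =
      F v (x v.castSucc) * (F' v (x v.succ) - F' v (y v.succ)) +
        ∑ i ∈ Finset.Ioi v, (F i (x i.castSucc) * F' i (x i.succ) -
          F i (y i.castSucc) * F' i (y i.succ)) := by
  rw [chain, chain, ← Finset.sum_sub_distrib, ← Finset.sum_subset (Finset.subset_univ (Finset.Ici v)),
    ← Finset.Ioi_insert, Finset.sum_insert (by simp), h _ le_rfl]
  · ring
  · intro i _ hi
    have hi : i < v := by simpa using hi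
    rw [h i.castSucc (by simpa using hi.le), h i.succ (by simpa [Fin.le_def] using hi), sub_self]

theorem block_shift_sum_eq_zero {r p q : ℕ} [NeZero p] {D : Type*} [AddCommGroup D] [Fintype D]
    {e₁ : AddChar (ZMod p) ℂ} (he₁ : e₁.IsPrimitive) (e : AddChar (ZMod q) ℂ)
    {F F' : Fin r → D → ZMod p} (hF : ∀ i, (F i).Bijective) (hF' : ∀ i, (F' i).Injective)
    (g : Fin (r + 1) → D → ZMod q) (v : Fin r)
    {x y : Fin (r + 1) → D} (h : ∀ k ≤ v.castSucc, x k = y k) (hv : x v.succ ≠ y v.succ) :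
    ∑ s : D, e₁ (chain F F' (x + Pi.single v.castSucc s) - chain F F' (y + Pi.single v.castSucc s)) *
      e (∑ k, (g k ((x + Pi.single v.castSucc s : Fin (r + 1) → D) k) -
        g k ((y + Pi.single v.castSucc s : Fin (r + 1) → D) k))) = 0 := by
  have hg (s : D) : ∑ k, (g k ((x + Pi.single v.castSucc s : Fin (r + 1) → D) k) -
        g k ((y + Pi.single v.castSucc s : Fin (r + 1) → D) k)) = ∑ k, (g k (x k) - g k (y k)) := by
    refine Finset.sum_congr rfl fun k _ => ?_
    by_cases hk : k = v.castSucc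
    · subst hk; simp [h _ le_rfl]
    · simp [hk]
  have hc (s : D) : chain F F' (x + Pi.single v.castSucc s) -
      chain F F' (y + Pi.single v.castSucc s) =
      F v (x v.castSucc + s) * (F' v (x v.succ) - F' v (y v.succ)) +
        ∑ i ∈ Finset.Ioi v, (F i (x i.castSucc) * F' i (x i.succ) -
          F i (y i.castSucc) * F' i (y i.succ)) := by
    rw [chain_sub_chain F F' v (fun k hk => by simp [h k hk])]
    congr 1
    · simp [Fin.ext_iff]
    · refine Finset.sum_congr rfl fun i hi => ?_
      have hi : v < i := by simpa using hi
      have h1 : i.castSucc ≠ v.castSucc := by simpa using hi.ne'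
      have h2 : i.succ ≠ v.castSucc := by
        simp only [ne_eq, Fin.ext_iff, Fin.val_succ, Fin.val_castSucc]; omega
      simp [h1, h2]
  simp only [hg, hc, AddChar.map_add_eq_mul, ← Finset.sum_mul]
  have hb : Function.Bijective fun s => F v (x v.castSucc + s) :=
    (hF v).comp (Equiv.addLeft (x v.castSucc)).bijective
  have hsum : ∑ s, e₁ (F v (x v.castSucc + s) * (F' v (x v.succ) - F' v (y v.succ))) = 0 := by
    rw [hb.sum_comp fun u => e₁ (u * (F' v (x v.succ) - F' v (y v.succ))),
      AddChar.sum_mulShift _ he₁, if_neg (sub_ne_zero.2 fun hh => hv (hF' v hh)), Nat.cast_zero]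
  rw [hsum, zero_mul, zero_mul]

theorem block_sum {r p q : ℕ} [NeZero p] {D : Type*} [AddCommGroup D] [Fintype D]
    {e₁ : AddChar (ZMod p) ℂ} (he₁ : e₁.IsPrimitive) (e : AddChar (ZMod q) ℂ)
    {F F' : Fin r → D → ZMod p} (hF : ∀ i, (F i).Bijective) (hF' : ∀ i, (F' i).Injective)
    (g : Fin (r + 1) → D → ZMod q) (N : Fin (r + 1) → D → ℤ) (σ : ℤ) (R : D → D → ℂ) :
    ∑ z : (Fin (r + 1) → D) × (Fin (r + 1) → D),
      (if ∑ k, N k (z.2 k) - ∑ k, N k (z.1 k) = σ ∧ z.1 0 = z.2 0 then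
        e₁ (chain F F' z.1 - chain F F' z.2) * e (∑ k, (g k (z.1 k) - g k (z.2 k))) *
          R (z.1 (Fin.last r)) (z.2 (Fin.last r)) else 0) =
    ∑ x : Fin (r + 1) → D, if σ = 0 then R (x (Fin.last r)) (x (Fin.last r)) else 0 := by
  set T : (Fin (r + 1) → D) × (Fin (r + 1) → D) → ℂ := fun z =>
    e₁ (chain F F' z.1 - chain F F' z.2) * e (∑ k, (g k (z.1 k) - g k (z.2 k))) *
          R (z.1 (Fin.last r)) (z.2 (Fin.last r)) with hT
  have step (v : Fin (r + 1)) :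
      ∑ z : (Fin (r + 1) → D) × (Fin (r + 1) → D),
        (if ∑ k, N k (z.2 k) - ∑ k, N k (z.1 k) = σ ∧ z.1 0 = z.2 0 then T z else 0) =
      ∑ z : (Fin (r + 1) → D) × (Fin (r + 1) → D),
        (if ∑ k, N k (z.2 k) - ∑ k, N k (z.1 k) = σ ∧ ∀ k ≤ v, z.1 k = z.2 k then T z else 0) := by
    induction v using Fin.induction with
    | zero => simp
    | succ v ih =>
      rw [ih, ← sub_eq_zero, ← Finset.sum_sub_distrib]
      refine Fintype.sum_eq_zero_of_shift _
        (fun s : D => (Pi.single v.castSucc s, Pi.single v.castSucc s)) ?_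
      rintro ⟨x, y⟩
      have hagree (w : Fin (r + 1)) (s : D) :
          (∀ k ≤ w, (x + Pi.single v.castSucc s : Fin (r + 1) → D) k =
            (y + Pi.single v.castSucc s : Fin (r + 1) → D) k) ↔ ∀ k ≤ w, x k = y k := by simp
      have hN (hxy : x v.castSucc = y v.castSucc) (s : D) :
          ∑ k, N k ((y + Pi.single v.castSucc s : Fin (r + 1) → D) k) -
            ∑ k, N k ((x + Pi.single v.castSucc s : Fin (r + 1) → D) k) =
          ∑ k, N k (y k) - ∑ k, N k (x k) := by
        rw [← Finset.sum_sub_distrib, ← Finset.sum_sub_distrib]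
        refine Finset.sum_congr rfl fun k _ => ?_
        by_cases hk : k = v.castSucc
        · subst hk; simp [hxy]
        · simp [hk]
      have hmono : (∀ k ≤ v.succ, x k = y k) ↔
          (∀ k ≤ v.castSucc, x k = y k) ∧ x v.succ = y v.succ := by
        constructor
        · exact fun h => ⟨fun k hk => h k (hk.trans (Fin.castSucc_lt_succ).le), h _ le_rfl⟩
        · rintro ⟨h, h'⟩ k hk
          rcases hk.lt_or_eq with hk | rfl
          · exact h k (Fin.le_castSucc_iff.2 hk)
          · exact h'
      simp only [Prod.mk_add_mk, hagree, hmono]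
      by_cases h : ∀ k ≤ v.castSucc, x k = y k
      swap
      · simp [h]
      by_cases hv : x v.succ = y v.succ
      · simp [hv]
      by_cases hσ : ∑ k, N k (y k) - ∑ k, N k (x k) = σ
      swap
      · simp only [hN (h _ le_rfl), hσ, false_and, if_false, sub_self, Finset.sum_const_zero]
      have hlast : Fin.last r ≠ v.castSucc := (Fin.castSucc_lt_last v).ne'
      simp only [hN (h _ le_rfl), hσ, eq_true h, hv, hT, and_false, and_true, if_false, if_true,
        sub_zero]
      simp only [Pi.add_apply, Pi.single_eq_of_ne hlast, add_zero]
      rw [← Finset.sum_mul, mul_eq_zero]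
      exact Or.inl (block_shift_sum_eq_zero he₁ e hF hF' g v h hv)
  rw [step (Fin.last r), Fintype.sum_prod_type]
  refine Finset.sum_congr rfl fun x _ => ?_
  rw [Finset.sum_eq_single x]
  · simp [hT, eq_comm]
  · intro y _ hy
    rw [if_neg]
    rintro ⟨-, h⟩
    exact hy (funext fun k => (h k (Fin.le_last k)).symm)
  · simp

theorem bijective_of_sum_eq_zero {p : ℕ} [NeZero p] {D : Type*} [Fintype D]
    (hD : Fintype.card D = p) {e₁ : AddChar (ZMod p) ℂ} (he₁ : e₁.IsPrimitive)
    {F F' : D → ZMod p} (h : ∀ a b, a ≠ b → ∑ u, e₁ (F u * (F' a - F' b)) = 0) :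
    F.Bijective ∧ F'.Bijective := by
  have hp : (p : ℂ) ≠ 0 := Nat.cast_ne_zero.2 (NeZero.ne p)
  have hcard : Fintype.card D = Fintype.card (ZMod p) := by rw [hD, ZMod.card]
  have hF' : F'.Bijective := by
    rw [Fintype.bijective_iff_injective_and_card]
    refine ⟨fun a b hab => ?_, hcard⟩
    by_contra hne
    have := h a b hne
    simp [hab, hD, hp] at this
  refine ⟨(Fintype.bijective_iff_surjective_and_card _).2 ⟨fun z => ?_, hcard⟩, hF'⟩
  by_contra! hz
  have h1 : ∑ c, ∑ u, e₁ ((F u - z) * c) = p := by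
    rw [Finset.sum_eq_single 0]
    · simp [hD]
    · intro c _ hc
      obtain ⟨a, rfl⟩ := hF'.2 c
      obtain ⟨b, hb⟩ := hF'.2 0
      have hab : a ≠ b := by rintro rfl; exact hc hb
      have := h a b hab
      rw [hb, sub_zero] at this
      simp only [sub_mul]
      simp only [sub_eq_add_neg, AddChar.map_add_eq_mul, ← Finset.sum_mul, this, zero_mul]
    · simp
  rw [Finset.sum_comm] at h1
  refine hp (h1.symm.trans (Finset.sum_eq_zero fun u _ => ?_))
  simp only [mul_comm (F u - z)]
  rw [AddChar.sum_mulShift _ he₁, if_neg (sub_ne_zero.2 (hz u)), Nat.cast_zero]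

theorem AddChar.map_sum_eq_prod {ι A : Type*} [AddCommGroup A] (ψ : AddChar A ℂ) (s : Finset ι)
    (f : ι → A) : ψ (∑ i ∈ s, f i) = ∏ i ∈ s, ψ (f i) := by
  induction s using Finset.induction_on with
  | empty => simp
  | insert a s ha ih => rw [Finset.sum_insert ha, Finset.prod_insert ha, ψ.map_add_eq_mul, ih]

theorem ZMod.indicator_sub_eq_two_iff {q : ℕ} (hq : 4 < q) {D : Type*} {a b : D} (hab : a ≠ b)
    (x y : D) :
    (((if x = a then 1 else 0) - (if x = b then 1 else 0)) -
      ((if y = a then 1 else 0) - (if y = b then 1 else 0)) : ZMod q) = 2 ↔ x = a ∧ y = b := by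
  have hcast : (((if x = a then 1 else 0) - (if x = b then 1 else 0)) -
      ((if y = a then 1 else 0) - (if y = b then 1 else 0)) - 2 : ZMod q) =
      ((((if x = a then 1 else 0) - (if x = b then 1 else 0)) -
      ((if y = a then 1 else 0) - (if y = b then 1 else 0)) - 2 : ℤ) : ZMod q) := by
    push_cast; rfl
  constructor
  · intro h
    rw [← sub_eq_zero, hcast, ZMod.intCast_zmod_eq_zero_iff_dvd _ q] at h
    have h0 := Int.eq_zero_of_abs_lt_dvd h (by rw [abs_lt]; constructor <;> split_ifs <;> omega)
    split_ifs at h0 <;> simp_all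
  · rintro ⟨rfl, rfl⟩
    simp [hab, hab.symm, one_add_one_eq_two]

theorem bijective_of_forall_sum_eq_zero {r p q : ℕ} [NeZero p] [NeZero q] (hq : 4 < q)
    {D : Type*} [Fintype D] (hD : Fintype.card D = p)
    {e₁ : AddChar (ZMod p) ℂ} (he₁ : e₁.IsPrimitive) {e : AddChar (ZMod q) ℂ} (he : e.IsPrimitive)
    (F F' : Fin r → D → ZMod p) (N : Fin (r + 1) → D → ℤ)
    {Y : Type*} [Fintype Y] [Nonempty Y] (N' : Y → ℤ)
    (hN : Function.Injective fun z : (Fin (r + 1) → D) × Y => ∑ k, N k (z.1 k) + N' z.2)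
    (K : Y → Y → ℂ) (hK : ∀ w, K w w = 1)
    (H : ∀ (g : Fin (r + 1) → D → ZMod q) (a b : (Fin (r + 1) → D) × Y), a ≠ b →
      ∑ z : (Fin (r + 1) → D) × Y, ∑ z' : (Fin (r + 1) → D) × Y,
        (if (∑ k, N k (z'.1 k) + N' z'.2) - (∑ k, N k (z.1 k) + N' z.2) =
            (∑ k, N k (b.1 k) + N' b.2) - (∑ k, N k (a.1 k) + N' a.2) ∧ z.1 0 = z'.1 0 then
          e₁ (chain F F' z.1 - chain F F' z'.1) * e (∑ k, (g k (z.1 k) - g k (z'.1 k))) *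
            K z.2 z'.2 else 0) = 0) (v : Fin r) :
    (F v).Bijective ∧ (F' v).Bijective := by
  obtain ⟨w₀⟩ := ‹Nonempty Y›
  refine bijective_of_sum_eq_zero hD he₁ fun a b hab => ?_
  set b' : Fin (r + 1) → D := fun k => if k ≤ v.castSucc then a else b with hb'
  set wt : Fin (r + 1) → D → ZMod q := fun k u =>
    if k ≤ v.castSucc then 0 else (if u = a then 1 else 0) - (if u = b then 1 else 0) with hwt
  have hwt_iff (k : Fin (r + 1)) (x y : D) :
      wt k x - wt k y - (wt k a - wt k (b' k)) = 0 ↔ (v.castSucc < k → x = a ∧ y = b) := by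
    by_cases hk : k ≤ v.castSucc
    · simp [hwt, hk, not_lt.2 hk]
    · rw [← ZMod.indicator_sub_eq_two_iff hq hab, sub_eq_zero]
      simp [hwt, hb', hk, not_le.1 hk, hab, hab.symm, one_add_one_eq_two]
  set C : (Fin (r + 1) → D) × Y → (Fin (r + 1) → D) × Y → Prop := fun z z' =>
    (∑ k, N k (z'.1 k) + N' z'.2) - (∑ k, N k (z.1 k) + N' z.2) =
      (∑ k, N k (b' k) + N' w₀) - (∑ k, N k a + N' w₀) ∧ z.1 0 = z'.1 0 with hC
  have hchar (c : Fin (r + 1) → ZMod q) :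
      ∑ s : Fin (r + 1) → ZMod q, e (∑ k, s k * c k) = ∏ k, if c k = 0 then (q : ℂ) else 0 := by
    have : ∀ k, (if c k = 0 then (q : ℂ) else 0) = ∑ t : ZMod q, e (t * c k) := fun k => by
      rw [AddChar.sum_mulShift _ he]; simp
    simp only [this, Finset.prod_univ_sum, Fintype.piFinset_univ, AddChar.map_sum_eq_prod]
  have havg : ∑ z, ∑ z', (if C z z' then
      e₁ (chain F F' z.1 - chain F F' z'.1) * K z.2 z'.2 *
        ∏ k, (if v.castSucc < k → z.1 k = a ∧ z'.1 k = b then (q : ℂ) else 0) else 0) = 0 := by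
    calc _ = ∑ s : Fin (r + 1) → ZMod q, e (-∑ k, s k * (wt k a - wt k (b' k))) *
        ∑ z, ∑ z', (if C z z' then
          e₁ (chain F F' z.1 - chain F F' z'.1) *
            e (∑ k, (s k * wt k (z.1 k) - s k * wt k (z'.1 k))) * K z.2 z'.2 else 0) := by
          simp only [Finset.mul_sum]
          symm
          rw [Finset.sum_comm]
          refine Finset.sum_congr rfl fun z _ => ?_
          rw [Finset.sum_comm]
          refine Finset.sum_congr rfl fun z' _ => ?_
          symm
          by_cases hc : C z z'
          · simp only [hc, if_true, ← hwt_iff, ← hchar, Finset.mul_sum]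
            refine Finset.sum_congr rfl fun s _ => ?_
            have : ∑ k, s k * (wt k (z.1 k) - wt k (z'.1 k) - (wt k a - wt k (b' k))) =
                -∑ k, s k * (wt k a - wt k (b' k)) +
                  ∑ k, (s k * wt k (z.1 k) - s k * wt k (z'.1 k)) := by
              rw [← Finset.sum_neg_distrib, ← Finset.sum_add_distrib]
              exact Finset.sum_congr rfl fun k _ => by ring
            rw [this, AddChar.map_add_eq_mul]
            ring
          · simp [hc]
      _ = 0 := Finset.sum_eq_zero fun s _ => by
          rw [H (fun k u => s k * wt k u) (fun _ => a, w₀) (b', w₀), mul_zero]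
          intro h
          have := congrFun (congrArg Prod.fst h) v.succ
          simp [hb', hab] at this
  set A := ∑ i ∈ Finset.Ioi v, (F i a * F' i a - F i b * F' i b) with hA
  set φ : Fin (r + 1) → D → ℂ := fun k u =>
    if k = v.castSucc then e₁ (F v u * (F' v a - F' v b)) else
      if v.castSucc < k then if u = a then 1 else 0 else 1 with hφ
  have hinner (z : (Fin (r + 1) → D) × Y) : ∑ z', (if C z z' then
      e₁ (chain F F' z.1 - chain F F' z'.1) * K z.2 z'.2 *
        ∏ k, (if v.castSucc < k → z.1 k = a ∧ z'.1 k = b then (q : ℂ) else 0) else 0) =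
      q ^ (r + 1) * e₁ A * ∏ k, φ k (z.1 k) := by
    by_cases hz : ∀ k, v.castSucc < k → z.1 k = a
    · rw [Finset.sum_eq_single ((fun k => if k ≤ v.castSucc then z.1 k else b), z.2)]
      · rw [if_pos, hK, chain_sub_chain F F' v (fun k hk => by simp [hk])]
        · have h1 : ∏ k, (if v.castSucc < k → z.1 k = a ∧
              (if k ≤ v.castSucc then z.1 k else b) = b then (q : ℂ) else 0) = q ^ (r + 1) := by
            rw [Finset.prod_congr rfl (g := fun _ => (q : ℂ)), Finset.prod_const,
              Finset.card_univ, Fintype.card_fin]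
            intro k _
            exact if_pos fun hk => ⟨hz k hk, if_neg (not_le.2 hk)⟩
          have h2 : ∏ k, φ k (z.1 k) = e₁ (F v (z.1 v.castSucc) * (F' v a - F' v b)) := by
            rw [Finset.prod_eq_single v.castSucc]
            · simp [hφ]
            · intro k _ hk
              simp only [hφ, if_neg hk]
              split_ifs with h3 h4
              · rfl
              · exact absurd (hz k h3) h4
              · rfl
            · simp
          have h3 : ∑ i ∈ Finset.Ioi v, (F i (z.1 i.castSucc) * F' i (z.1 i.succ) -
              F i (if i.castSucc ≤ v.castSucc then z.1 i.castSucc else b) *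
                F' i (if i.succ ≤ v.castSucc then z.1 i.succ else b)) = A := by
            refine Finset.sum_congr rfl fun i hi => ?_
            have hi1 : v.castSucc < i.castSucc := by simpa using hi
            have hi2 : v.castSucc < i.succ := hi1.trans Fin.castSucc_lt_succ
            rw [hz _ hi1, hz _ hi2, if_neg (not_le.2 hi1), if_neg (not_le.2 hi2)]
          have h4 : v.castSucc < v.succ := Fin.castSucc_lt_succ
          simp only [h1, h2, h3, if_neg (not_le.2 h4), hz _ h4, AddChar.map_add_eq_mul]
          ring
        · refine ⟨?_, by simp⟩
          simp only [add_sub_add_right_eq_sub, ← Finset.sum_sub_distrib]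
          refine Finset.sum_congr rfl fun k _ => ?_
          by_cases hk : k ≤ v.castSucc
          · simp [hb', hk]
          · simp [hb', hk, hz k (not_le.1 hk)]
      · intro z' _ hz'
        by_cases hc : C z z'
        swap
        · rw [if_neg hc]
        by_cases hb : ∀ k, v.castSucc < k → z'.1 k = b
        swap
        · push Not at hb
          obtain ⟨k, hk, hkb⟩ := hb
          rw [if_pos hc, Finset.prod_eq_zero (Finset.mem_univ k), mul_zero]
          simp [hk, hkb]
        exfalso
        have key : ((fun k => if k ≤ v.castSucc then z'.1 k else a), z'.2) = z := by
          apply hN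
          have h5 : ∑ k, N k (if k ≤ v.castSucc then z'.1 k else a) =
              ∑ k, N k (z'.1 k) - (∑ k, N k (b' k) - ∑ k, N k a) := by
            rw [← Finset.sum_sub_distrib, ← Finset.sum_sub_distrib]
            refine Finset.sum_congr rfl fun k _ => ?_
            by_cases hk : k ≤ v.castSucc
            · simp [hb', hk]
            · simp [hb', hk, hb k (not_le.1 hk)]
          simp only [h5]
          have := hc.1
          linarith
        apply hz'
        rw [← key]
        refine Prod.ext (funext fun k => ?_) rfl
        by_cases hk : k ≤ v.castSucc
        · simp [hk]
        · simp [hk, hb k (not_le.1 hk)]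
      · simp
    · push Not at hz
      obtain ⟨k, hk, hka⟩ := hz
      rw [Finset.prod_eq_zero (Finset.mem_univ k), mul_zero]
      · refine Finset.sum_eq_zero fun z' _ => ?_
        rw [Finset.prod_eq_zero (Finset.mem_univ k), mul_zero, ite_self]
        simp [hk, hka]
      · simp [hφ, hk, hk.ne', hka]
  have hfst (f : (Fin (r + 1) → D) → ℂ) :
      ∑ z : (Fin (r + 1) → D) × Y, f z.1 = Fintype.card Y * ∑ x, f x := by
    simp [Fintype.sum_prod_type, Finset.mul_sum]
  have hprod := Finset.prod_univ_sum (fun _ : Fin (r + 1) => (Finset.univ : Finset D)) φ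
  rw [Fintype.piFinset_univ] at hprod
  simp only [hinner, ← Finset.mul_sum] at havg
  rw [hfst fun x => ∏ k, φ k (x k), ← hprod] at havg
  have hq0 : (q : ℂ) ≠ 0 := Nat.cast_ne_zero.2 (NeZero.ne q)
  have hY : (Fintype.card Y : ℂ) ≠ 0 := Nat.cast_ne_zero.2 Fintype.card_ne_zero
  have hA0 : e₁ A ≠ 0 := (e₁.val_isUnit A).ne_zero
  have hp0 : (p : ℂ) ≠ 0 := Nat.cast_ne_zero.2 (NeZero.ne p)
  simp only [mul_eq_zero, pow_eq_zero_iff', hq0, hA0, hY,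
    false_and, false_or, Finset.prod_eq_zero_iff] at havg
  obtain ⟨k, -, hk⟩ := havg
  by_cases hkv : k = v.castSucc
  · simpa [hφ, hkv] using hk
  · by_cases hlt : v.castSucc < k
    · simp [hφ, hkv, hlt] at hk
    · simp [hφ, hkv, hlt, hD, hp0] at hk

theorem accf_eq_sum (L : ℕ) (a b : ℕ → ℂ) (τ : ℤ) :
    accf L a b τ = ∑ i : Fin L, ∑ j : Fin L,
      if ((j : ℕ) : ℤ) - ((i : ℕ) : ℤ) = τ then a i * (starRingEnd ℂ) (b j) else 0 := by
  have key (n : ℕ) (f : ℕ → ℕ → ℂ) : ∑ t ∈ Finset.range (L - n), f t (t + n) =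
      ∑ i : Fin L, ∑ j : Fin L, if (j : ℕ) = i + n then f i j else 0 := by
    rw [Fin.sum_univ_eq_sum_range
      (fun i => ∑ j : Fin L, if (j : ℕ) = i + n then f i j else 0) L]
    have h (i : ℕ) : (∑ j : Fin L, if (j : ℕ) = i + n then f i j else 0) =
        if i + n < L then f i (i + n) else 0 := by
      rw [Fin.sum_univ_eq_sum_range (fun j => if j = i + n then f i j else 0) L]
      simp
    simp only [h]
    rw [← Finset.sum_filter]
    refine Finset.sum_congr ?_ fun _ _ => rfl
    ext i
    simp only [Finset.mem_range, Finset.mem_filter]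
    omega
  rw [accf]
  split_ifs with hτ
  · rw [key τ.toNat fun i j => a i * (starRingEnd ℂ) (b j)]
    refine Finset.sum_congr rfl fun i _ => Finset.sum_congr rfl fun j _ => if_congr ?_ rfl rfl
    omega
  · rw [key (-τ).toNat fun j i => a i * (starRingEnd ℂ) (b j), Finset.sum_comm]
    refine Finset.sum_congr rfl fun i _ => Finset.sum_congr rfl fun j _ => if_congr ?_ rfl rfl
    omega

theorem xi_pow_val {q : ℕ} [NeZero q] (z : ZMod q) : xi q ^ z.val = ZMod.stdAddChar z := by
  rw [xi, ← Complex.exp_nat_mul, ZMod.stdAddChar_apply, ZMod.toCircle_apply]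
  congr 1
  ring

theorem ZMod.stdAddChar_natCast_mul {a b q : ℕ} [NeZero a] [NeZero q] (h : q = a * b)
    (hd : a ∣ q) (z : ZMod q) :
    ZMod.stdAddChar ((b : ZMod q) * z) = ZMod.stdAddChar (ZMod.castHom hd (ZMod a) z) := by
  obtain ⟨n, rfl⟩ := ZMod.natCast_zmod_surjective z
  have ha : (a : ℂ) ≠ 0 := Nat.cast_ne_zero.2 (NeZero.ne a)
  have hq : (a * b : ℂ) ≠ 0 := by exact_mod_cast h ▸ NeZero.ne q
  have hb : (b : ℂ) ≠ 0 := right_ne_zero_of_mul hq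
  rw [map_natCast, ← Nat.cast_mul, ZMod.stdAddChar_apply, ZMod.stdAddChar_apply,
    ZMod.toCircle_natCast, ZMod.toCircle_natCast, h]
  congr 1
  push_cast
  field_simp

theorem AddChar.map_sub_eq_mul_conj {A : Type*} [AddCommGroup A] [Finite A] (ψ : AddChar A ℂ)
    (a b : A) : ψ (a - b) = ψ a * (starRingEnd ℂ) (ψ b) := by
  rw [sub_eq_add_neg, ψ.map_add_eq_mul, ψ.map_neg_eq_conj]

theorem Fin.natCast_zmod_bijective (p : ℕ) [NeZero p] :
    Function.Bijective fun u : Fin p => ((u : ℕ) : ZMod p) := by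
  rw [Fintype.bijective_iff_injective_and_card]
  refine ⟨fun u v h => Fin.ext ?_, by simp [ZMod.card]⟩
  have := (ZMod.natCast_eq_natCast_iff' _ _ _).1 h
  rwa [Nat.mod_eq_of_lt u.2, Nat.mod_eq_of_lt v.2] at this

theorem Fin.sum_stdAddChar_mul {p : ℕ} [NeZero p] (u v : Fin p) :
    ∑ d : Fin p, ZMod.stdAddChar (((d : ℕ) : ZMod p) * (((u : ℕ) : ZMod p) - ((v : ℕ) : ZMod p))) =
      if u = v then (p : ℂ) else 0 := by
  rw [(Fin.natCast_zmod_bijective p).sum_comp fun d =>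
    ZMod.stdAddChar (d * (((u : ℕ) : ZMod p) - ((v : ℕ) : ZMod p))),
    AddChar.sum_mulShift _ (ZMod.isPrimitive_stdAddChar p)]
  have : ((u : ℕ) : ZMod p) - ((v : ℕ) : ZMod p) = 0 ↔ u = v := by
    rw [sub_eq_zero]; exact (Fin.natCast_zmod_bijective p).1.eq_iff
  simp [this]

theorem sum_stdAddChar_mul_last {r p : ℕ} [NeZero p] (a : ZMod p) :
    ∑ x : Fin (r + 1) → Fin p, ZMod.stdAddChar (a * ((x (Fin.last r) : ℕ) : ZMod p)) =
      if a = 0 then (p : ℂ) ^ (r + 1) else 0 := by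
  split_ifs with ha
  · simp [ha]
  · refine Fintype.sum_eq_zero_of_shift _ (fun s : Fin p => Pi.single (Fin.last r) s) fun x => ?_
    simp only [Pi.add_apply, Pi.single_eq_same]
    have hb : Function.Bijective fun s : Fin p => (((x (Fin.last r) + s : Fin p) : ℕ) : ZMod p) :=
      (Fin.natCast_zmod_bijective p).comp (Equiv.addLeft (x (Fin.last r))).bijective
    rw [hb.sum_comp fun u => ZMod.stdAddChar (a * u)]
    simp only [mul_comm a]
    rw [AddChar.sum_mulShift _ (ZMod.isPrimitive_stdAddChar p), if_neg ha, Nat.cast_zero]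

/-- The map `{0, …, p - 1} → ℤ_p` induced by `φ : ℤ_q → ℤ_q` under reduction modulo `p ∣ q`. -/
def reduceMod {q p : ℕ} (hd : p ∣ q) (φ : ZMod q → ZMod q) (u : Fin p) : ZMod p :=
  ZMod.castHom hd (ZMod p) (φ ((u : ℕ) : ZMod q))

theorem permutesMod_iff {q p : ℕ} (hd : p ∣ q) [NeZero q] (φ : ZMod q → ZMod q) :
    PermutesMod q p φ ↔ (reduceMod hd φ).Bijective := by
  have : reduceMod hd φ = fun u : Fin p => (((φ ((u : ℕ) : ZMod q)).val : ℕ) : ZMod p) :=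
    funext fun u => by rw [reduceMod, ZMod.natCast_val, ZMod.castHom_apply]
  rw [PermutesMod, this]

/-- The bijection sending digit vectors, listed in the orders `π` and `π'` within the two blocks,
to the integer with these mixed-radix digits. -/
def mixedRadixEquiv (p₁ p₂ n₁ n₂ : ℕ) (π : Equiv.Perm (Fin n₁)) (π' : Equiv.Perm (Fin n₂)) :
    ((Fin n₁ → Fin p₁) × (Fin n₂ → Fin p₂)) ≃ Fin (p₁ ^ n₁ * p₂ ^ n₂) :=
  ((((π.arrowCongr (Equiv.refl _)).trans finFunctionFinEquiv).prodCongr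
    ((π'.arrowCongr (Equiv.refl _)).trans finFunctionFinEquiv)).trans
      (Equiv.prodComm _ _)).trans (finProdFinEquiv.trans (finCongr (mul_comm _ _)))

section MixedRadix

variable {p₁ p₂ n₁ n₂ : ℕ} (π : Equiv.Perm (Fin n₁)) (π' : Equiv.Perm (Fin n₂))
  (z : (Fin n₁ → Fin p₁) × (Fin n₂ → Fin p₂))

theorem mixedRadixEquiv_val :
    (mixedRadixEquiv p₁ p₂ n₁ n₂ π π' z : ℕ) =
      (finFunctionFinEquiv (z.1 ∘ π.symm) : ℕ) +
        p₁ ^ n₁ * (finFunctionFinEquiv (z.2 ∘ π'.symm) : ℕ) := rfl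

theorem mixedRadixEquiv_val_eq_sum :
    ((mixedRadixEquiv p₁ p₂ n₁ n₂ π π' z : ℕ) : ℤ) =
      ∑ k, ((z.1 k : ℕ) : ℤ) * p₁ ^ (π k : ℕ) +
        ∑ k, (p₁ : ℤ) ^ n₁ * (((z.2 k : ℕ) : ℤ) * p₂ ^ (π' k : ℕ)) := by
  rw [mixedRadixEquiv_val, finFunctionFinEquiv_apply, finFunctionFinEquiv_apply,
    ← Equiv.sum_comp π, ← Equiv.sum_comp π', ← Finset.mul_sum]
  simp

theorem mdig_mixedRadixEquiv_left (k : Fin n₁) :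
    mdig p₁ p₂ n₁ (mixedRadixEquiv p₁ p₂ n₁ n₂ π π' z) (π k) = z.1 k := by
  rw [mdig, if_pos (π k).2, mixedRadixEquiv_val, Nat.add_mul_mod_self_left,
    Nat.mod_eq_of_lt (Fin.is_lt _), ← finFunctionFinEquiv_symm_apply_val]
  simp

theorem mdig_mixedRadixEquiv_right (k : Fin n₂) :
    mdig p₁ p₂ n₁ (mixedRadixEquiv p₁ p₂ n₁ n₂ π π' z) (n₁ + π' k) = z.2 k := by
  have hpos : 0 < p₁ ^ n₁ := (Fin.is_lt (finFunctionFinEquiv (z.1 ∘ π.symm))).pos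
  rw [mdig, if_neg (by omega), mixedRadixEquiv_val, Nat.add_mul_div_left _ _ hpos,
    Nat.div_eq_of_lt (Fin.is_lt _), zero_add, Nat.add_sub_cancel_left,
    ← finFunctionFinEquiv_symm_apply_val]
  simp

end MixedRadix

section Correlation

open ZMod (stdAddChar)

variable {p₁ p₂ r₁ r₂ : ℕ} [NeZero p₁] [NeZero p₂] (hm₁ : 2 ≤ r₁ + 1) (hm₂ : 2 ≤ r₂ + 1)
  (fi f'i : Fin r₁ → ZMod (p₁ * p₂) → ZMod (p₁ * p₂))
  (hj h'j : Fin r₂ → ZMod (p₁ * p₂) → ZMod (p₁ * p₂))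
  (f₀ h₀ : ZMod (p₁ * p₂) → ZMod (p₁ * p₂))
  (g : Fin (r₁ + 1) → ZMod (p₁ * p₂) → ZMod (p₁ * p₂))
  (g' : Fin (r₂ + 1) → ZMod (p₁ * p₂) → ZMod (p₁ * p₂))
  (γ : ZMod (p₁ * p₂)) (π : Equiv.Perm (Fin (r₁ + 1))) (π' : Equiv.Perm (Fin (r₂ + 1)))

theorem psi2_mixedRadixEquiv (t : ℕ) (d : Fin p₁ × Fin p₂)
    (z : (Fin (r₁ + 1) → Fin p₁) × (Fin (r₂ + 1) → Fin p₂)) :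
    psi2 p₁ p₂ (r₁ + 1) (r₂ + 1) hm₁ hm₂ fi f'i hj h'j f₀ h₀ g g' γ π π' t d
        (mixedRadixEquiv p₁ p₂ (r₁ + 1) (r₂ + 1) π π' z) =
      stdAddChar (chain (fun i => reduceMod (Nat.dvd_mul_right p₁ p₂) (fi i))
        (fun i => reduceMod (Nat.dvd_mul_right p₁ p₂) (f'i i)) z.1) *
      stdAddChar (∑ k, g (π k) ((z.1 k : ℕ) : ZMod (p₁ * p₂))) *
      (stdAddChar (chain (fun i => reduceMod (Nat.dvd_mul_left p₂ p₁) (hj i))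
        (fun i => reduceMod (Nat.dvd_mul_left p₂ p₁) (h'j i)) z.2) *
      stdAddChar (∑ k, g' (π' k) ((z.2 k : ℕ) : ZMod (p₁ * p₂)))) *
      (stdAddChar (γ * f₀ ((z.1 (Fin.last r₁) : ℕ) : ZMod (p₁ * p₂)) *
        h₀ ((z.2 0 : ℕ) : ZMod (p₁ * p₂))) *
      stdAddChar (((t % p₁ : ℕ) : ZMod p₁) * ((z.1 (Fin.last r₁) : ℕ) : ZMod p₁)) *
      stdAddChar (((t / p₁ : ℕ) : ZMod p₂) * ((z.2 (Fin.last r₂) : ℕ) : ZMod p₂))) *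
      (stdAddChar (((d.1 : ℕ) : ZMod p₁) * ((z.1 0 : ℕ) : ZMod p₁)) *
      stdAddChar (((d.2 : ℕ) : ZMod p₂) * ((z.2 0 : ℕ) : ZMod p₂))) := by
  have hL (k : Fin (r₁ + 1)) : mdigZ (p₁ * p₂) p₁ p₂ (r₁ + 1)
      (mixedRadixEquiv p₁ p₂ (r₁ + 1) (r₂ + 1) π π' z) (π k) = ((z.1 k : ℕ) : ZMod (p₁ * p₂)) := by
    rw [mdigZ, mdig_mixedRadixEquiv_left]
  have hR (k : Fin (r₂ + 1)) : mdigZ (p₁ * p₂) p₁ p₂ (r₁ + 1)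
      (mixedRadixEquiv p₁ p₂ (r₁ + 1) (r₂ + 1) π π' z) (r₁ + 1 + π' k) =
        ((z.2 k : ℕ) : ZMod (p₁ * p₂)) := by
    rw [mdigZ, mdig_mixedRadixEquiv_right]
  have hd₁ : p₁ * p₂ / p₁ = p₂ := Nat.mul_div_cancel_left _ (NeZero.pos p₁)
  have hd₂ : p₁ * p₂ / p₂ = p₁ := Nat.mul_div_cancel _ (NeZero.pos p₂)
  have hf : f2 p₁ p₂ (r₁ + 1) (r₂ + 1) hm₁ hm₂ fi f'i hj h'j f₀ h₀ g g' γ π π'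
      (mixedRadixEquiv p₁ p₂ (r₁ + 1) (r₂ + 1) π π' z) =
      (p₂ : ZMod (p₁ * p₂)) * (∑ i : Fin r₁, fi i ((z.1 i.castSucc : ℕ) : ZMod (p₁ * p₂)) *
        f'i i ((z.1 i.succ : ℕ) : ZMod (p₁ * p₂))) +
      (∑ k, g (π k) ((z.1 k : ℕ) : ZMod (p₁ * p₂))) +
      (p₁ : ZMod (p₁ * p₂)) * (∑ i : Fin r₂, hj i ((z.2 i.castSucc : ℕ) : ZMod (p₁ * p₂)) *
        h'j i ((z.2 i.succ : ℕ) : ZMod (p₁ * p₂))) +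
      (∑ k, g' (π' k) ((z.2 k : ℕ) : ZMod (p₁ * p₂))) +
      γ * f₀ ((z.1 (Fin.last r₁) : ℕ) : ZMod (p₁ * p₂)) *
        h₀ ((z.2 0 : ℕ) : ZMod (p₁ * p₂)) := by
    rw [f2]
    simp only [hL, hR, hd₁, hd₂]
    rw [← Equiv.sum_comp π, ← Equiv.sum_comp π']
    simp only [hL, hR]
    rfl
  rw [psi2, xi_pow_val]
  simp only [hf, hL, hR, hd₁, hd₂]
  simp only [AddChar.map_add_eq_mul, mul_add]
  rw [ZMod.stdAddChar_natCast_mul rfl (Nat.dvd_mul_right p₁ p₂),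
    ZMod.stdAddChar_natCast_mul rfl (Nat.dvd_mul_right p₁ p₂),
    ZMod.stdAddChar_natCast_mul rfl (Nat.dvd_mul_right p₁ p₂),
    ZMod.stdAddChar_natCast_mul (mul_comm p₁ p₂) (Nat.dvd_mul_left p₂ p₁),
    ZMod.stdAddChar_natCast_mul (mul_comm p₁ p₂) (Nat.dvd_mul_left p₂ p₁),
    ZMod.stdAddChar_natCast_mul (mul_comm p₁ p₂) (Nat.dvd_mul_left p₂ p₁)]
  simp only [map_sum, map_mul, map_natCast, chain, reduceMod]
  have hlast₁ : (⟨r₁ + 1 - 1, by omega⟩ : Fin (r₁ + 1)) = Fin.last r₁ := rfl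
  have hlast₂ : (⟨r₂ + 1 - 1, by omega⟩ : Fin (r₂ + 1)) = Fin.last r₂ := rfl
  simp only [hlast₁, hlast₂, Fin.zero_eta]
  ring

theorem codeACCF_psi2 (t t' : ℕ) (τ : ℤ) :
    codeACCF (p₁ ^ (r₁ + 1) * p₂ ^ (r₂ + 1))
      (psi2 p₁ p₂ (r₁ + 1) (r₂ + 1) hm₁ hm₂ fi f'i hj h'j f₀ h₀ g g' γ π π' t)
      (psi2 p₁ p₂ (r₁ + 1) (r₂ + 1) hm₁ hm₂ fi f'i hj h'j f₀ h₀ g g' γ π π' t') τ =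
    p₁ * p₂ * ∑ z : (Fin (r₁ + 1) → Fin p₁) × (Fin (r₂ + 1) → Fin p₂),
      ∑ z' : (Fin (r₁ + 1) → Fin p₁) × (Fin (r₂ + 1) → Fin p₂),
      if ((mixedRadixEquiv p₁ p₂ (r₁ + 1) (r₂ + 1) π π' z' : ℕ) : ℤ) -
          ((mixedRadixEquiv p₁ p₂ (r₁ + 1) (r₂ + 1) π π' z : ℕ) : ℤ) = τ ∧
          z.1 0 = z'.1 0 ∧ z.2 0 = z'.2 0 then
        stdAddChar (chain (fun i => reduceMod (Nat.dvd_mul_right p₁ p₂) (fi i))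
            (fun i => reduceMod (Nat.dvd_mul_right p₁ p₂) (f'i i)) z.1 -
          chain (fun i => reduceMod (Nat.dvd_mul_right p₁ p₂) (fi i))
            (fun i => reduceMod (Nat.dvd_mul_right p₁ p₂) (f'i i)) z'.1) *
        stdAddChar (∑ k, (g (π k) ((z.1 k : ℕ) : ZMod (p₁ * p₂)) -
          g (π k) ((z'.1 k : ℕ) : ZMod (p₁ * p₂)))) *
        (stdAddChar (chain (fun i => reduceMod (Nat.dvd_mul_left p₂ p₁) (hj i))
            (fun i => reduceMod (Nat.dvd_mul_left p₂ p₁) (h'j i)) z.2 -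
          chain (fun i => reduceMod (Nat.dvd_mul_left p₂ p₁) (hj i))
            (fun i => reduceMod (Nat.dvd_mul_left p₂ p₁) (h'j i)) z'.2) *
        stdAddChar (∑ k, (g' (π' k) ((z.2 k : ℕ) : ZMod (p₁ * p₂)) -
          g' (π' k) ((z'.2 k : ℕ) : ZMod (p₁ * p₂))))) *
        (stdAddChar (γ * f₀ ((z.1 (Fin.last r₁) : ℕ) : ZMod (p₁ * p₂)) *
            h₀ ((z.2 0 : ℕ) : ZMod (p₁ * p₂)) -
          γ * f₀ ((z'.1 (Fin.last r₁) : ℕ) : ZMod (p₁ * p₂)) *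
            h₀ ((z'.2 0 : ℕ) : ZMod (p₁ * p₂))) *
        stdAddChar (((t % p₁ : ℕ) : ZMod p₁) * ((z.1 (Fin.last r₁) : ℕ) : ZMod p₁) -
          ((t' % p₁ : ℕ) : ZMod p₁) * ((z'.1 (Fin.last r₁) : ℕ) : ZMod p₁)) *
        stdAddChar (((t / p₁ : ℕ) : ZMod p₂) * ((z.2 (Fin.last r₂) : ℕ) : ZMod p₂) -
          ((t' / p₁ : ℕ) : ZMod p₂) * ((z'.2 (Fin.last r₂) : ℕ) : ZMod p₂)))
      else 0 := by
  simp only [codeACCF, accf_eq_sum, Finset.mul_sum]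
  simp only [← Equiv.sum_comp (mixedRadixEquiv p₁ p₂ (r₁ + 1) (r₂ + 1) π π')]
  rw [Finset.sum_comm]
  refine Finset.sum_congr rfl fun z _ => ?_
  rw [Finset.sum_comm]
  refine Finset.sum_congr rfl fun z' _ => ?_
  by_cases hτ : ((mixedRadixEquiv p₁ p₂ (r₁ + 1) (r₂ + 1) π π' z' : ℕ) : ℤ) -
          ((mixedRadixEquiv p₁ p₂ (r₁ + 1) (r₂ + 1) π π' z : ℕ) : ℤ) = τ
  swap
  · simp [hτ]
  simp only [hτ, if_true, true_and, psi2_mixedRadixEquiv]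
  have hd : (∑ d : Fin p₁ × Fin p₂,
      stdAddChar (((d.1 : ℕ) : ZMod p₁) * (((z.1 0 : ℕ) : ZMod p₁) - ((z'.1 0 : ℕ) : ZMod p₁))) *
      stdAddChar (((d.2 : ℕ) : ZMod p₂) * (((z.2 0 : ℕ) : ZMod p₂) - ((z'.2 0 : ℕ) : ZMod p₂)))) =
      (if z.1 0 = z'.1 0 ∧ z.2 0 = z'.2 0 then (p₁ * p₂ : ℂ) else 0) := by
    rw [Fintype.sum_prod_type]
    dsimp only
    rw [← Finset.sum_mul_sum, Fin.sum_stdAddChar_mul,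
      Fin.sum_stdAddChar_mul]
    split_ifs <;> simp_all
  have hmul (X : ℂ) : (p₁ * p₂ : ℂ) * (if z.1 0 = z'.1 0 ∧ z.2 0 = z'.2 0 then X else 0) =
      (if z.1 0 = z'.1 0 ∧ z.2 0 = z'.2 0 then (p₁ * p₂ : ℂ) else 0) * X := by
    split_ifs <;> simp
  rw [hmul, ← hd, Finset.sum_mul]
  refine Finset.sum_congr rfl fun d _ => ?_
  simp only [Finset.sum_sub_distrib, mul_sub, AddChar.map_sub_eq_mul_conj, map_mul]
  ring

end Correlation

theorem Fintype.sum_prod_sum_prod {α β M : Type*} [Fintype α] [Fintype β] [AddCommMonoid M]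
    (f : α → β → α → β → M) : ∑ z : α × β, ∑ z' : α × β, f z.1 z.2 z'.1 z'.2 =
      ∑ w : β × β, ∑ v : α × α, f v.1 w.1 v.2 w.2 := by
  simp only [Fintype.sum_prod_type]
  rw [Finset.sum_comm]
  refine Finset.sum_congr rfl fun b _ => ?_
  rw [Finset.sum_comm (γ := β) (α := α)]
  exact Finset.sum_congr rfl fun a _ => Finset.sum_comm

theorem two_block_sum {r₁ r₂ p₁ p₂ q : ℕ} [NeZero p₁] [NeZero p₂] {D₁ D₂ : Type*}
    [AddCommGroup D₁] [Fintype D₁] [AddCommGroup D₂] [Fintype D₂]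
    {e₁ : AddChar (ZMod p₁) ℂ} (he₁ : e₁.IsPrimitive)
    {e₂ : AddChar (ZMod p₂) ℂ} (he₂ : e₂.IsPrimitive) (e : AddChar (ZMod q) ℂ)
    {F₁ F₁' : Fin r₁ → D₁ → ZMod p₁} (hF₁ : ∀ i, (F₁ i).Bijective) (hF₁' : ∀ i, (F₁' i).Injective)
    {F₂ F₂' : Fin r₂ → D₂ → ZMod p₂} (hF₂ : ∀ i, (F₂ i).Bijective) (hF₂' : ∀ i, (F₂' i).Injective)
    (g₁ : Fin (r₁ + 1) → D₁ → ZMod q) (g₂ : Fin (r₂ + 1) → D₂ → ZMod q)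
    (N₁ : Fin (r₁ + 1) → D₁ → ℤ) (N₂ : Fin (r₂ + 1) → D₂ → ℤ) (τ : ℤ)
    (c : D₁ → D₂ → ZMod q) (R₁ : D₁ → D₁ → ℂ) (R₂ : D₂ → D₂ → ℂ) :
    ∑ z : (Fin (r₁ + 1) → D₁) × (Fin (r₂ + 1) → D₂),
      ∑ z' : (Fin (r₁ + 1) → D₁) × (Fin (r₂ + 1) → D₂),
      (if (∑ k, N₁ k (z'.1 k) + ∑ k, N₂ k (z'.2 k)) - (∑ k, N₁ k (z.1 k) + ∑ k, N₂ k (z.2 k)) = τ ∧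
          z.1 0 = z'.1 0 ∧ z.2 0 = z'.2 0 then
        e₁ (chain F₁ F₁' z.1 - chain F₁ F₁' z'.1) * e (∑ k, (g₁ k (z.1 k) - g₁ k (z'.1 k))) *
        (e₂ (chain F₂ F₂' z.2 - chain F₂ F₂' z'.2) * e (∑ k, (g₂ k (z.2 k) - g₂ k (z'.2 k)))) *
        (e (c (z.1 (Fin.last r₁)) (z.2 0) - c (z'.1 (Fin.last r₁)) (z'.2 0)) *
          R₁ (z.1 (Fin.last r₁)) (z'.1 (Fin.last r₁)) *
          R₂ (z.2 (Fin.last r₂)) (z'.2 (Fin.last r₂)))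
      else 0) =
    if τ = 0 then (∑ x : Fin (r₁ + 1) → D₁, R₁ (x (Fin.last r₁)) (x (Fin.last r₁))) *
      ∑ y : Fin (r₂ + 1) → D₂, R₂ (y (Fin.last r₂)) (y (Fin.last r₂)) else 0 := by
  rw [Fintype.sum_prod_sum_prod fun x y x' y' =>
    if (∑ k, N₁ k (x' k) + ∑ k, N₂ k (y' k)) - (∑ k, N₁ k (x k) + ∑ k, N₂ k (y k)) = τ ∧
        x 0 = x' 0 ∧ y 0 = y' 0 then
      e₁ (chain F₁ F₁' x - chain F₁ F₁' x') * e (∑ k, (g₁ k (x k) - g₁ k (x' k))) *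
      (e₂ (chain F₂ F₂' y - chain F₂ F₂' y') * e (∑ k, (g₂ k (y k) - g₂ k (y' k)))) *
      (e (c (x (Fin.last r₁)) (y 0) - c (x' (Fin.last r₁)) (y' 0)) *
        R₁ (x (Fin.last r₁)) (x' (Fin.last r₁)) * R₂ (y (Fin.last r₂)) (y' (Fin.last r₂)))
    else 0]
  set S₁ := ∑ x : Fin (r₁ + 1) → D₁, R₁ (x (Fin.last r₁)) (x (Fin.last r₁)) with hS₁
  have inner (w : (Fin (r₂ + 1) → D₂) × (Fin (r₂ + 1) → D₂)) :
      ∑ v : (Fin (r₁ + 1) → D₁) × (Fin (r₁ + 1) → D₁),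
      (if (∑ k, N₁ k (v.2 k) + ∑ k, N₂ k (w.2 k)) - (∑ k, N₁ k (v.1 k) + ∑ k, N₂ k (w.1 k)) = τ ∧
          v.1 0 = v.2 0 ∧ w.1 0 = w.2 0 then
        e₁ (chain F₁ F₁' v.1 - chain F₁ F₁' v.2) * e (∑ k, (g₁ k (v.1 k) - g₁ k (v.2 k))) *
        (e₂ (chain F₂ F₂' w.1 - chain F₂ F₂' w.2) * e (∑ k, (g₂ k (w.1 k) - g₂ k (w.2 k)))) *
        (e (c (v.1 (Fin.last r₁)) (w.1 0) - c (v.2 (Fin.last r₁)) (w.2 0)) *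
          R₁ (v.1 (Fin.last r₁)) (v.2 (Fin.last r₁)) *
          R₂ (w.1 (Fin.last r₂)) (w.2 (Fin.last r₂)))
      else 0) =
      if ∑ k, N₂ k (w.2 k) - ∑ k, N₂ k (w.1 k) = τ ∧ w.1 0 = w.2 0 then
        e₂ (chain F₂ F₂' w.1 - chain F₂ F₂' w.2) * e (∑ k, (g₂ k (w.1 k) - g₂ k (w.2 k))) *
          (S₁ * R₂ (w.1 (Fin.last r₂)) (w.2 (Fin.last r₂))) else 0 := by
    by_cases hw : w.1 0 = w.2 0
    swap
    · simp [hw]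
    have hb := block_sum he₁ e hF₁ hF₁' g₁ N₁ (τ - (∑ k, N₂ k (w.2 k) - ∑ k, N₂ k (w.1 k)))
      fun a b => e (c a (w.1 0) - c b (w.2 0)) * R₁ a b *
        (e₂ (chain F₂ F₂' w.1 - chain F₂ F₂' w.2) * e (∑ k, (g₂ k (w.1 k) - g₂ k (w.2 k))) *
          R₂ (w.1 (Fin.last r₂)) (w.2 (Fin.last r₂)))
    have hτ : τ - (∑ k, N₂ k (w.2 k) - ∑ k, N₂ k (w.1 k)) = 0 ↔
      ∑ k, N₂ k (w.2 k) - ∑ k, N₂ k (w.1 k) = τ := by omega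
    simp only [hτ] at hb
    refine (Finset.sum_congr rfl fun v _ => if_congr ?_ (by ring) rfl).trans (hb.trans ?_)
    · rw [and_iff_left hw]
      exact and_congr_left' (by omega)
    · simp only [hw, sub_self, AddChar.map_zero_eq_one, one_mul, and_true]
      split_ifs with h
      · rw [← Finset.sum_mul, ← hS₁]; ring
      · simp
  rw [Finset.sum_congr rfl fun w _ => inner w,
    block_sum he₂ e hF₂ hF₂' g₂ N₂ τ fun a b => S₁ * R₂ a b]
  split_ifs
  · rw [Finset.mul_sum]
  · simp

section Equivalence

open ZMod (stdAddChar)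

variable {p₁ p₂ r₁ r₂ : ℕ} [NeZero p₁] [NeZero p₂] (hm₁ : 2 ≤ r₁ + 1) (hm₂ : 2 ≤ r₂ + 1)
  {fi f'i : Fin r₁ → ZMod (p₁ * p₂) → ZMod (p₁ * p₂)}
  {hj h'j : Fin r₂ → ZMod (p₁ * p₂) → ZMod (p₁ * p₂)}

theorem isCCC_psi2
    (hfi : ∀ i, PermutesMod (p₁ * p₂) p₁ (fi i)) (hf'i : ∀ i, PermutesMod (p₁ * p₂) p₁ (f'i i))
    (hhj : ∀ j, PermutesMod (p₁ * p₂) p₂ (hj j)) (hh'j : ∀ j, PermutesMod (p₁ * p₂) p₂ (h'j j))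
    (f₀ h₀ : ZMod (p₁ * p₂) → ZMod (p₁ * p₂))
    (g : Fin (r₁ + 1) → ZMod (p₁ * p₂) → ZMod (p₁ * p₂))
    (g' : Fin (r₂ + 1) → ZMod (p₁ * p₂) → ZMod (p₁ * p₂))
    (γ : ZMod (p₁ * p₂)) (π : Equiv.Perm (Fin (r₁ + 1))) (π' : Equiv.Perm (Fin (r₂ + 1))) :
    IsCCC (p₁ ^ (r₁ + 1) * p₂ ^ (r₂ + 1)) (fun t : Fin (p₁ * p₂) =>
      psi2 p₁ p₂ (r₁ + 1) (r₂ + 1) hm₁ hm₂ fi f'i hj h'j f₀ h₀ g g' γ π π' t.val) := by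
  refine ⟨by simp, fun t t' τ _ => ?_⟩
  rw [codeACCF_psi2]
  simp only [mixedRadixEquiv_val_eq_sum]
  refine (congrArg _ (Eq.trans ?_ (two_block_sum (ZMod.isPrimitive_stdAddChar p₁) (ZMod.isPrimitive_stdAddChar p₂)
    (stdAddChar (N := p₁ * p₂))
    (fun i => (permutesMod_iff (Nat.dvd_mul_right p₁ p₂) _).1 (hfi i))
    (fun i => ((permutesMod_iff (Nat.dvd_mul_right p₁ p₂) _).1 (hf'i i)).1)
    (fun j => (permutesMod_iff (Nat.dvd_mul_left p₂ p₁) _).1 (hhj j))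
    (fun j => ((permutesMod_iff (Nat.dvd_mul_left p₂ p₁) _).1 (hh'j j)).1)
    (fun k u => g (π k) ((u : ℕ) : ZMod (p₁ * p₂)))
    (fun k u => g' (π' k) ((u : ℕ) : ZMod (p₁ * p₂)))
    (fun k u => ((u : ℕ) : ℤ) * p₁ ^ (π k : ℕ))
    (fun k u => (p₁ : ℤ) ^ (r₁ + 1) * (((u : ℕ) : ℤ) * p₂ ^ (π' k : ℕ))) τ
    (fun u v => γ * f₀ ((u : ℕ) : ZMod (p₁ * p₂)) * h₀ ((v : ℕ) : ZMod (p₁ * p₂)))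
    (fun u v => stdAddChar ((((t : ℕ) % p₁ : ℕ) : ZMod p₁) * ((u : ℕ) : ZMod p₁) -
      (((t' : ℕ) % p₁ : ℕ) : ZMod p₁) * ((v : ℕ) : ZMod p₁)))
    (fun u v => stdAddChar ((((t : ℕ) / p₁ : ℕ) : ZMod p₂) * ((u : ℕ) : ZMod p₂) -
      (((t' : ℕ) / p₁ : ℕ) : ZMod p₂) * ((v : ℕ) : ZMod p₂)))))).trans ?_
  · congr!
  simp only [← sub_mul, sum_stdAddChar_mul_last]
  have ht (s : Fin (p₁ * p₂)) : (s : ℕ) / p₁ < p₂ := Nat.div_lt_of_lt_mul s.2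
  have h₁ : (((t : ℕ) % p₁ : ℕ) : ZMod p₁) - (((t' : ℕ) % p₁ : ℕ) : ZMod p₁) = 0 ↔
      (t : ℕ) % p₁ = (t' : ℕ) % p₁ := by
    rw [sub_eq_zero, ZMod.natCast_eq_natCast_iff', Nat.mod_mod, Nat.mod_mod]
  have h₂ : (((t : ℕ) / p₁ : ℕ) : ZMod p₂) - (((t' : ℕ) / p₁ : ℕ) : ZMod p₂) = 0 ↔
      (t : ℕ) / p₁ = (t' : ℕ) / p₁ := by
    rw [sub_eq_zero, ZMod.natCast_eq_natCast_iff', Nat.mod_eq_of_lt (ht t),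
      Nat.mod_eq_of_lt (ht t')]
  have h : t = t' ↔ (t : ℕ) % p₁ = (t' : ℕ) % p₁ ∧ (t : ℕ) / p₁ = (t' : ℕ) / p₁ := by
    refine ⟨fun h => by simp [h], fun h => Fin.ext ?_⟩
    rw [← Nat.mod_add_div t p₁, ← Nat.mod_add_div t' p₁, h.1, h.2]
  simp only [h₁, h₂, h, Fintype.card_fin, Nat.cast_mul, Nat.cast_pow]
  split_ifs <;> simp_all

theorem sum_eq_zero_of_isCCC
    (H : ∀ (f₀ h₀ : ZMod (p₁ * p₂) → ZMod (p₁ * p₂))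
        (g : Fin (r₁ + 1) → ZMod (p₁ * p₂) → ZMod (p₁ * p₂))
        (g' : Fin (r₂ + 1) → ZMod (p₁ * p₂) → ZMod (p₁ * p₂))
        (γ : ZMod (p₁ * p₂)) (π : Equiv.Perm (Fin (r₁ + 1))) (π' : Equiv.Perm (Fin (r₂ + 1))),
      IsCCC (p₁ ^ (r₁ + 1) * p₂ ^ (r₂ + 1)) (fun t : Fin (p₁ * p₂) =>
        psi2 p₁ p₂ (r₁ + 1) (r₂ + 1) hm₁ hm₂ fi f'i hj h'j f₀ h₀ g g' γ π π' t.val))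
    (g : Fin (r₁ + 1) → Fin p₁ → ZMod (p₁ * p₂)) (g' : Fin (r₂ + 1) → Fin p₂ → ZMod (p₁ * p₂))
    {a b : (Fin (r₁ + 1) → Fin p₁) × (Fin (r₂ + 1) → Fin p₂)} (hab : a ≠ b) :
    ∑ z : (Fin (r₁ + 1) → Fin p₁) × (Fin (r₂ + 1) → Fin p₂),
      ∑ z' : (Fin (r₁ + 1) → Fin p₁) × (Fin (r₂ + 1) → Fin p₂),
      (if ((mixedRadixEquiv p₁ p₂ (r₁ + 1) (r₂ + 1) 1 1 z' : ℕ) : ℤ) -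
          ((mixedRadixEquiv p₁ p₂ (r₁ + 1) (r₂ + 1) 1 1 z : ℕ) : ℤ) =
          ((mixedRadixEquiv p₁ p₂ (r₁ + 1) (r₂ + 1) 1 1 b : ℕ) : ℤ) -
          ((mixedRadixEquiv p₁ p₂ (r₁ + 1) (r₂ + 1) 1 1 a : ℕ) : ℤ) ∧
          z.1 0 = z'.1 0 ∧ z.2 0 = z'.2 0 then
        stdAddChar (chain (fun i => reduceMod (Nat.dvd_mul_right p₁ p₂) (fi i))
            (fun i => reduceMod (Nat.dvd_mul_right p₁ p₂) (f'i i)) z.1 -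
          chain (fun i => reduceMod (Nat.dvd_mul_right p₁ p₂) (fi i))
            (fun i => reduceMod (Nat.dvd_mul_right p₁ p₂) (f'i i)) z'.1) *
        stdAddChar (∑ k, (g k (z.1 k) - g k (z'.1 k))) *
        (stdAddChar (chain (fun i => reduceMod (Nat.dvd_mul_left p₂ p₁) (hj i))
            (fun i => reduceMod (Nat.dvd_mul_left p₂ p₁) (h'j i)) z.2 -
          chain (fun i => reduceMod (Nat.dvd_mul_left p₂ p₁) (hj i))
            (fun i => reduceMod (Nat.dvd_mul_left p₂ p₁) (h'j i)) z'.2) *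
        stdAddChar (∑ k, (g' k (z.2 k) - g' k (z'.2 k))))
      else 0) = 0 := by
  have hp₁ : ∀ u : Fin p₁, Fin.ofNat p₁ ((u : ℕ) : ZMod (p₁ * p₂)).val = u := fun u => by
    rw [ZMod.val_natCast_of_lt (u.2.trans_le (Nat.le_mul_of_pos_right _ (NeZero.pos p₂)))]
    exact Fin.ext (Nat.mod_eq_of_lt u.2)
  have hp₂ : ∀ u : Fin p₂, Fin.ofNat p₂ ((u : ℕ) : ZMod (p₁ * p₂)).val = u := fun u => by
    rw [ZMod.val_natCast_of_lt (u.2.trans_le (Nat.le_mul_of_pos_left _ (NeZero.pos p₁)))]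
    exact Fin.ext (Nat.mod_eq_of_lt u.2)
  have hne : mixedRadixEquiv p₁ p₂ (r₁ + 1) (r₂ + 1) 1 1 a ≠
      mixedRadixEquiv p₁ p₂ (r₁ + 1) (r₂ + 1) 1 1 b := (Equiv.injective _).ne hab
  have ha := (mixedRadixEquiv p₁ p₂ (r₁ + 1) (r₂ + 1) 1 1 a).2
  have hb := (mixedRadixEquiv p₁ p₂ (r₁ + 1) (r₂ + 1) 1 1 b).2
  have hne' := Fin.val_ne_of_ne hne
  have key := (H 0 0 (fun k w => g k (Fin.ofNat p₁ w.val)) (fun k w => g' k (Fin.ofNat p₂ w.val))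
    0 1 1).2 0 0 (((mixedRadixEquiv p₁ p₂ (r₁ + 1) (r₂ + 1) 1 1 b : ℕ) : ℤ) -
          ((mixedRadixEquiv p₁ p₂ (r₁ + 1) (r₂ + 1) 1 1 a : ℕ) : ℤ)) (by
            rw [abs_lt]; constructor <;> omega)
  rw [if_neg (by omega), codeACCF_psi2, mul_eq_zero, or_iff_right (by simp [NeZero.ne])] at key
  simp only [hp₁, hp₂] at key
  simpa using key

theorem permutesMod_of_isCCC (hq : 4 < p₁ * p₂)
    (H : ∀ (f₀ h₀ : ZMod (p₁ * p₂) → ZMod (p₁ * p₂))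
        (g : Fin (r₁ + 1) → ZMod (p₁ * p₂) → ZMod (p₁ * p₂))
        (g' : Fin (r₂ + 1) → ZMod (p₁ * p₂) → ZMod (p₁ * p₂))
        (γ : ZMod (p₁ * p₂)) (π : Equiv.Perm (Fin (r₁ + 1))) (π' : Equiv.Perm (Fin (r₂ + 1))),
      IsCCC (p₁ ^ (r₁ + 1) * p₂ ^ (r₂ + 1)) (fun t : Fin (p₁ * p₂) =>
        psi2 p₁ p₂ (r₁ + 1) (r₂ + 1) hm₁ hm₂ fi f'i hj h'j f₀ h₀ g g' γ π π' t.val)) :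
    (∀ i, PermutesMod (p₁ * p₂) p₁ (fi i) ∧ PermutesMod (p₁ * p₂) p₁ (f'i i)) ∧
      ∀ j, PermutesMod (p₁ * p₂) p₂ (hj j) ∧ PermutesMod (p₁ * p₂) p₂ (h'j j) := by
  simp only [permutesMod_iff (Nat.dvd_mul_right p₁ p₂), permutesMod_iff (Nat.dvd_mul_left p₂ p₁)]
  have hinj := Int.ofNat_injective.comp (Fin.val_injective.comp
    (mixedRadixEquiv p₁ p₂ (r₁ + 1) (r₂ + 1) 1 1).injective)
  have hval := mixedRadixEquiv_val_eq_sum (p₁ := p₁) (p₂ := p₂) (n₁ := r₁ + 1) (n₂ := r₂ + 1) 1 1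
  constructor
  · refine bijective_of_forall_sum_eq_zero hq (Fintype.card_fin p₁)
      (ZMod.isPrimitive_stdAddChar p₁) (ZMod.isPrimitive_stdAddChar (p₁ * p₂)) _ _
      (fun k u => ((u : ℕ) : ℤ) * p₁ ^ ((1 : Equiv.Perm (Fin (r₁ + 1))) k : ℕ))
      (fun w : Fin (r₂ + 1) → Fin p₂ => ∑ k, (p₁ : ℤ) ^ (r₁ + 1) *
        (((w k : ℕ) : ℤ) * p₂ ^ ((1 : Equiv.Perm (Fin (r₂ + 1))) k : ℕ)))
      (fun z z' h => hinj ?_)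
      (fun w w' => if w 0 = w' 0 then
        stdAddChar (chain (fun i => reduceMod (Nat.dvd_mul_left p₂ p₁) (hj i))
            (fun i => reduceMod (Nat.dvd_mul_left p₂ p₁) (h'j i)) w -
          chain (fun i => reduceMod (Nat.dvd_mul_left p₂ p₁) (hj i))
            (fun i => reduceMod (Nat.dvd_mul_left p₂ p₁) (h'j i)) w') else 0)
      (fun w => by simp) fun g a b hab => ?_
    · exact (hval z).trans (h.trans (hval z').symm)
    · have key := sum_eq_zero_of_isCCC hm₁ hm₂ H g 0 hab
      simp only [hval] at key
      refine (Finset.sum_congr rfl fun z _ => Finset.sum_congr rfl fun z' _ => ?_).trans key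
      by_cases h₂ : z.2 0 = z'.2 0
      · simp [h₂]
      · simp [h₂]
  · refine bijective_of_forall_sum_eq_zero hq (Fintype.card_fin p₂)
      (ZMod.isPrimitive_stdAddChar p₂) (ZMod.isPrimitive_stdAddChar (p₁ * p₂)) _ _
      (fun k u => (p₁ : ℤ) ^ (r₁ + 1) *
        (((u : ℕ) : ℤ) * p₂ ^ ((1 : Equiv.Perm (Fin (r₂ + 1))) k : ℕ)))
      (fun w : Fin (r₁ + 1) → Fin p₁ =>
        ∑ k, ((w k : ℕ) : ℤ) * p₁ ^ ((1 : Equiv.Perm (Fin (r₁ + 1))) k : ℕ))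
      (fun z z' h => Prod.swap_injective (hinj ?_))
      (fun w w' => if w 0 = w' 0 then
        stdAddChar (chain (fun i => reduceMod (Nat.dvd_mul_right p₁ p₂) (fi i))
            (fun i => reduceMod (Nat.dvd_mul_right p₁ p₂) (f'i i)) w -
          chain (fun i => reduceMod (Nat.dvd_mul_right p₁ p₂) (fi i))
            (fun i => reduceMod (Nat.dvd_mul_right p₁ p₂) (f'i i)) w') else 0)
      (fun w => by simp) fun g a b hab => ?_
    · exact (hval z.swap).trans ((add_comm _ _).trans
        (h.trans ((add_comm _ _).trans (hval z'.swap).symm)))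
    · have key := sum_eq_zero_of_isCCC hm₁ hm₂ H 0 g (Prod.swap_injective.ne hab)
      simp only [hval] at key
      refine (Fintype.sum_equiv (Equiv.prodComm _ _) _ _ fun z =>
        Fintype.sum_equiv (Equiv.prodComm _ _) _ _ fun z' => ?_).trans key
      by_cases h₁ : z.2 0 = z'.2 0
      · simp [h₁, add_comm, mul_comm]
      · simp [h₁]

end Equivalence

/-- Theorem 2: with `f_i, f'_i, h_j, h'_j` fixed, the family
`{ψ(C_t) : 0 ≤ t < p₁p₂}` is a `(p₁p₂, p₁^{m₁}p₂^{m₂})`-CCC for every choice of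
`f₀, h₀, g_α, g'_β, γ, π, π'` iff every `f_i, f'_i` permutes `{0,…,p₁−1}` under
reduction mod `p₁` and every `h_j, h'_j` permutes `{0,…,p₂−1}` under reduction
mod `p₂`. -/
theorem stmt_11 (p₁ p₂ m₁ m₂ : ℕ) (hp₁ : p₁.Prime) (hp₂ : p₂.Prime) (hlt : p₁ < p₂)
    (hm₁ : 2 ≤ m₁) (hm₂ : 2 ≤ m₂)
    (fi f'i : Fin (m₁ - 1) → ZMod (p₁ * p₂) → ZMod (p₁ * p₂))
    (hj h'j : Fin (m₂ - 1) → ZMod (p₁ * p₂) → ZMod (p₁ * p₂)) :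
    (∀ (f₀ h₀ : ZMod (p₁ * p₂) → ZMod (p₁ * p₂))
        (g : Fin m₁ → ZMod (p₁ * p₂) → ZMod (p₁ * p₂))
        (g' : Fin m₂ → ZMod (p₁ * p₂) → ZMod (p₁ * p₂))
        (γ : ZMod (p₁ * p₂)) (π : Equiv.Perm (Fin m₁)) (π' : Equiv.Perm (Fin m₂)),
        IsCCC (p₁ ^ m₁ * p₂ ^ m₂)
          (fun t : Fin (p₁ * p₂) =>
            psi2 p₁ p₂ m₁ m₂ hm₁ hm₂ fi f'i hj h'j f₀ h₀ g g' γ π π' t.val)) ↔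
      ((∀ i, PermutesMod (p₁ * p₂) p₁ (fi i) ∧ PermutesMod (p₁ * p₂) p₁ (f'i i)) ∧
        (∀ j, PermutesMod (p₁ * p₂) p₂ (hj j) ∧ PermutesMod (p₁ * p₂) p₂ (h'j j))) := by
  obtain ⟨r₁, rfl⟩ : ∃ r, m₁ = r + 1 := ⟨m₁ - 1, by omega⟩
  obtain ⟨r₂, rfl⟩ : ∃ r, m₂ = r + 1 := ⟨m₂ - 1, by omega⟩
  have : NeZero p₁ := ⟨hp₁.ne_zero⟩
  have : NeZero p₂ := ⟨hp₂.ne_zero⟩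
  have hq : 4 < p₁ * p₂ := by nlinarith [hp₁.two_le]
  exact ⟨permutesMod_of_isCCC hm₁ hm₂ hq, fun h => isCCC_psi2 hm₁ hm₂ (fun i => (h.1 i).1)
    (fun i => (h.1 i).2) (fun j => (h.2 j).1) fun j => (h.2 j).2⟩
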